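/- Score-to-parameter estimation reduction: let γ > 1, σ > 0, u ∈ S^{d-1}, and let P_u be the (γ,σ)-Gaussian pancakes distribution. Suppose û ∈ S^{d-1} satisfies 1 − ⟨û,u⟩² ≤ η² for some η ∈ (0,1). Then the plug-in score estimate ŝ(x) = −2πx + (log T_γ^σ)'(⟨x,û⟩)·û satisfies E_{x∼P_u} ‖ŝ(x) − ∇log P_u(x)‖² ≤ C · max(1, 1/σ⁸) · η² · d for a universal constant C. -/

import Mathlib

open Real MeasureTheory

/-- Gaussian mass of the lattice `(1/γ)ℤ`. -/
noncomputable def latticeMass (γ : ℝ) : ℝ :=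
  ∑' k : ℤ, Real.exp (-Real.pi * ((k : ℝ) / γ) ^ 2)

/-- Likelihood ratio `T_γ^σ` of the σ-smoothed discrete Gaussian on `(1/γ)ℤ`
with respect to `N(0, 1/(2π))`. -/
noncomputable def pancakeLR (γ σ z : ℝ) : ℝ :=
  (Real.sqrt (1 + σ ^ 2) / (σ * latticeMass γ)) *
    ∑' k : ℤ, Real.exp (-Real.pi * (z - Real.sqrt (1 + σ ^ 2) * (k : ℝ) / γ) ^ 2 / σ ^ 2)

/-- The standard Gaussian `Q_d = N(0, (1/(2π)) I_d)` on `Fin d → ℝ`. -/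
noncomputable def stdGaussian (d : ℕ) : Measure (Fin d → ℝ) :=
  Measure.pi fun _ => ProbabilityTheory.gaussianReal 0 ((2 * Real.pi)⁻¹).toNNReal

/-- The `(γ,σ)`-Gaussian pancakes distribution with secret direction `u`. -/
noncomputable def pancakes (d : ℕ) (γ σ : ℝ) (u : Fin d → ℝ) : Measure (Fin d → ℝ) :=
  (stdGaussian d).withDensity fun x => ENNReal.ofReal (pancakeLR γ σ (∑ i, x i * u i))

/-- The score function `∇ log P_v(x) = −2πx + (T'/T)(⟨x,v⟩)·v` (componentwise),
which is also the plug-in score estimate when `v` is an estimated direction. -/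
noncomputable def pancakesScoreFun (d : ℕ) (γ σ : ℝ) (v x : Fin d → ℝ) : Fin d → ℝ :=
  fun i => -(2 * Real.pi) * x i +
    (deriv (pancakeLR γ σ) (∑ j, x j * v j) / pancakeLR γ σ (∑ j, x j * v j)) * v i


/-- Moment series of the lattice `bℤ`. -/
noncomputable def hSer (b : ℝ) (n : ℕ) (y : ℝ) : ℝ :=
  ∑' k : ℤ, (k : ℝ) ^ n * Real.exp (2 * π * b * y * k - π * b ^ 2 * (k : ℝ) ^ 2)

lemma hSer_bound {b : ℝ} (hb : 0 < b) (n : ℕ) {R y : ℝ} (hy : |y| ≤ R) (k : ℤ) :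
    ‖(k : ℝ) ^ n * Real.exp (2 * π * b * y * k - π * b ^ 2 * (k : ℝ) ^ 2)‖ ≤
      (|k| ^ n : ℝ) * Real.exp (-π * (b ^ 2 * k ^ 2 - 2 * (b * R) * |k|)) := by
  rw [norm_mul, norm_pow, Real.norm_eq_abs, Real.norm_eq_abs, Real.abs_exp]
  push_cast
  gcongr
  have h1 : y * k ≤ R * |(k : ℝ)| := by
    calc y * k ≤ |y * k| := le_abs_self _
      _ = |y| * |(k : ℝ)| := abs_mul _ _
      _ ≤ _ := by gcongr
  have : 2 * π * b * (y * k) ≤ 2 * π * b * (R * |(k : ℝ)|) := by gcongr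
  linarith

lemma hSer_summable {b : ℝ} (hb : 0 < b) (n : ℕ) (y : ℝ) :
    Summable fun k : ℤ =>
      (k : ℝ) ^ n * Real.exp (2 * π * b * y * k - π * b ^ 2 * (k : ℝ) ^ 2) :=
  (summable_pow_mul_jacobiTheta₂_term_bound (b * |y|) (pow_pos hb 2) n).of_norm_bounded
    fun k => hSer_bound hb n le_rfl k

lemma hSer_hasDerivAt {b : ℝ} (hb : 0 < b) (n : ℕ) (y : ℝ) :
    HasDerivAt (hSer b n) (2 * π * b * hSer b (n + 1) y) y := by
  unfold hSer
  rw [← tsum_mul_left]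
  have hmem : y ∈ Metric.ball (0 : ℝ) (|y| + 1) := by simp
  refine hasDerivAt_tsum_of_isPreconnected
    (u := fun k : ℤ => 2 * π * b * ((|k| ^ (n + 1) : ℝ) *
      Real.exp (-π * (b ^ 2 * k ^ 2 - 2 * (b * (|y| + 1)) * |k|))))
    (t := Metric.ball 0 (|y| + 1))
    (g' := fun (k : ℤ) (z : ℝ) => 2 * π * b * ((k : ℝ) ^ (n + 1) *
      Real.exp (2 * π * b * z * k - π * b ^ 2 * (k : ℝ) ^ 2)))
    ?_ Metric.isOpen_ball (convex_ball _ _).isPreconnected ?_ ?_ hmem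
    (hSer_summable hb n y) hmem
  · exact (summable_pow_mul_jacobiTheta₂_term_bound _ (pow_pos hb 2) _).mul_left _
  · intro k z _
    have h : HasDerivAt (fun z : ℝ => 2 * π * b * z * k - π * b ^ 2 * (k : ℝ) ^ 2)
        (2 * π * b * k) z := by
      have := (((hasDerivAt_id z).const_mul (2 * π * b)).mul_const (k : ℝ)).sub_const
        (π * b ^ 2 * (k : ℝ) ^ 2)
      simpa using this
    refine (h.exp.const_mul ((k : ℝ) ^ n)).congr_deriv ?_
    ring
  · intro k z hz
    rw [norm_mul, Real.norm_of_nonneg (by positivity : 0 ≤ 2 * π * b)]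
    gcongr
    refine hSer_bound hb (n + 1) ?_ k
    simpa using (mem_ball_zero_iff.1 hz).le

lemma hSer_zero_pos {b : ℝ} (hb : 0 < b) (y : ℝ) : 0 < hSer b 0 y := by
  refine (hSer_summable hb 0 y).tsum_pos (fun k => ?_) 0 ?_
  · positivity
  · positivity

lemma hSer_cauchy {b : ℝ} (hb : 0 < b) (y : ℝ) :
    hSer b 1 y ^ 2 ≤ hSer b 2 y * hSer b 0 y := by
  have h0 := hSer_zero_pos hb y
  set m := hSer b 1 y / hSer b 0 y with hm
  have s0 := (hSer_summable hb 0 y).hasSum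
  have s1 := (hSer_summable hb 1 y).hasSum
  have s2 := (hSer_summable hb 2 y).hasSum
  have hs := (s2.sub (s1.mul_left (2 * m))).add (s0.mul_left (m ^ 2))
  have : 0 ≤ hSer b 2 y - 2 * m * hSer b 1 y + m ^ 2 * hSer b 0 y := by
    refine hs.nonneg fun k => ?_
    have : 0 ≤ ((k : ℝ) - m) ^ 2 *
      Real.exp (2 * π * b * y * k - π * b ^ 2 * (k : ℝ) ^ 2) := by positivity
    refine this.trans (le_of_eq ?_)
    ring
  have e : hSer b 1 y = m * hSer b 0 y := by rw [hm]; field_simp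
  rw [e] at this ⊢
  nlinarith

lemma sq_mul_exp_le {t : ℝ} (ht : 0 ≤ t) : t ^ 2 * Real.exp (-π * t) ≤ 1 := by
  have h1 : t ^ 2 ≤ Real.exp (2 * t) := by
    have := Real.add_one_le_exp t
    rw [two_mul, Real.exp_add]
    nlinarith
  calc t ^ 2 * Real.exp (-π * t) ≤ Real.exp (2 * t) * Real.exp (-π * t) := by gcongr
    _ = Real.exp ((2 - π) * t) := by rw [← Real.exp_add]; ring_nf
    _ ≤ 1 := by
      rw [Real.exp_le_one_iff]
      nlinarith [Real.pi_gt_three]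

lemma shift_bound_aux {D t : ℝ} (hD : 1 ≤ D) (ht : D ≤ t) :
    t ^ 2 * Real.exp (-π * t ^ 2) ≤ Real.exp (-π * (t - D) ^ 2) := by
  have h : Real.exp (-π * t ^ 2) ≤ Real.exp (-π * t) * Real.exp (-π * (t - D) ^ 2) := by
    rw [← Real.exp_add, Real.exp_le_exp]
    have : 0 ≤ π * (2 * t * D - D ^ 2 - t) := by
      have : 0 ≤ 2 * t * D - D ^ 2 - t := by nlinarith
      positivity
    nlinarith
  calc t ^ 2 * Real.exp (-π * t ^ 2)
      ≤ t ^ 2 * (Real.exp (-π * t) * Real.exp (-π * (t - D) ^ 2)) := by gcongr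
    _ = (t ^ 2 * Real.exp (-π * t)) * Real.exp (-π * (t - D) ^ 2) := by ring
    _ ≤ 1 * Real.exp (-π * (t - D) ^ 2) := by
      gcongr; exact sq_mul_exp_le (by linarith)
    _ = _ := one_mul _

lemma shift_bound {D : ℝ} (hD : 1 ≤ D) (t : ℝ) :
    t ^ 2 * Real.exp (-π * t ^ 2) ≤ D ^ 2 * Real.exp (-π * t ^ 2) +
      Real.exp (-π * (t - D) ^ 2) + Real.exp (-π * (t + D) ^ 2) := by
  have p1 := Real.exp_pos (-π * t ^ 2)
  have p2 := Real.exp_pos (-π * (t - D) ^ 2)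
  have p3 := Real.exp_pos (-π * (t + D) ^ 2)
  by_cases h1 : D ≤ t
  · have := shift_bound_aux hD h1
    nlinarith [sq_nonneg D]
  by_cases h2 : D ≤ -t
  · have := shift_bound_aux hD h2
    rw [neg_sq, show (-t - D) ^ 2 = (t + D) ^ 2 by ring] at this
    nlinarith [sq_nonneg D]
  have : t ^ 2 ≤ D ^ 2 := by
    push Not at h1 h2
    nlinarith
  nlinarith

lemma exp_shift_eq (b y : ℝ) (k : ℤ) : Real.exp (-π * (y - b * k) ^ 2) =
    Real.exp (-π * y ^ 2) *
      ((k : ℝ) ^ 0 * Real.exp (2 * π * b * y * k - π * b ^ 2 * (k : ℝ) ^ 2)) := by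
  rw [pow_zero, one_mul, ← Real.exp_add]; ring_nf

lemma F_hasSum {b : ℝ} (hb : 0 < b) (y : ℝ) :
    HasSum (fun k : ℤ => Real.exp (-π * (y - b * k) ^ 2))
      (Real.exp (-π * y ^ 2) * hSer b 0 y) := by
  simp_rw [exp_shift_eq]
  exact (hSer_summable hb 0 y).hasSum.mul_left _

lemma F2_hasSum {b : ℝ} (hb : 0 < b) (y : ℝ) :
    HasSum (fun k : ℤ => (y - b * k) ^ 2 * Real.exp (-π * (y - b * k) ^ 2))
      (Real.exp (-π * y ^ 2) * (y ^ 2 * hSer b 0 y - 2 * y * b * hSer b 1 y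
        + b ^ 2 * hSer b 2 y)) := by
  have s0 := (hSer_summable hb 0 y).hasSum
  have s1 := (hSer_summable hb 1 y).hasSum
  have s2 := (hSer_summable hb 2 y).hasSum
  have hs := (((s0.mul_left (y ^ 2)).sub (s1.mul_left (2 * y * b))).add
    (s2.mul_left (b ^ 2))).mul_left (Real.exp (-π * y ^ 2))
  refine Eq.mp (congrArg (fun f => HasSum f _) (funext fun k => ?_)) hs
  rw [exp_shift_eq]
  ring

lemma key_bound {b : ℝ} (hb : 0 < b) (y : ℝ) :
    y ^ 2 * hSer b 0 y - 2 * y * b * hSer b 1 y + b ^ 2 * hSer b 2 y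
      ≤ (4 + 2 * b ^ 2) * hSer b 0 y := by
  obtain ⟨m, hm1, hm2⟩ : ∃ m : ℤ, 1 ≤ b * m ∧ b * m ≤ 1 + b := by
    refine ⟨⌈1 / b⌉, ?_, ?_⟩
    · have := Int.le_ceil (1 / b)
      calc 1 = b * (1 / b) := by field_simp
        _ ≤ _ := by gcongr
    · have := (Int.ceil_lt_add_one (1 / b)).le
      calc b * (⌈1 / b⌉ : ℝ) ≤ b * (1 / b + 1) := by gcongr
        _ = 1 + b := by field_simp
  have hF := F_hasSum hb y
  have hF2 := F2_hasSum hb y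
  have hp : HasSum (fun k : ℤ => Real.exp (-π * ((y - b * k) - b * m) ^ 2))
      (Real.exp (-π * y ^ 2) * hSer b 0 y) := by
    have := (Equiv.addRight m).hasSum_iff.2 hF
    convert this using 2 with k
    simp only [Function.comp, Equiv.coe_addRight]; push_cast; ring_nf
  have hq : HasSum (fun k : ℤ => Real.exp (-π * ((y - b * k) + b * m) ^ 2))
      (Real.exp (-π * y ^ 2) * hSer b 0 y) := by
    have := (Equiv.addRight (-m)).hasSum_iff.2 hF
    convert this using 2 with k
    simp only [Function.comp, Equiv.coe_addRight]; push_cast; ring_nf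
  have := hasSum_le (fun k : ℤ => shift_bound hm1 (y - b * k)) hF2
    (((hF.mul_left ((b * m) ^ 2)).add hp).add hq)
  have e := Real.exp_pos (-π * y ^ 2)
  have h0 := hSer_zero_pos hb y
  have h3 : y ^ 2 * hSer b 0 y - 2 * y * b * hSer b 1 y + b ^ 2 * hSer b 2 y
      ≤ ((b * m) ^ 2 + 2) * hSer b 0 y := by
    refine le_of_mul_le_mul_left (this.trans (le_of_eq ?_)) e
    ring
  refine h3.trans ?_
  refine mul_le_mul_of_nonneg_right ?_ h0.le
  nlinarith [sq_nonneg (b - 1)]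

/-- Logarithmic derivative of the normalised series. -/
noncomputable def GSer (b y : ℝ) : ℝ := -(2 * π) * y + 2 * π * b * (hSer b 1 y / hSer b 0 y)

lemma GSer_sq_le {b : ℝ} (hb : 0 < b) (y : ℝ) :
    GSer b y ^ 2 ≤ 4 * π ^ 2 * (4 + 2 * b ^ 2) := by
  have h0 := hSer_zero_pos hb y
  have hc := hSer_cauchy hb y
  have hk := key_bound hb y
  unfold GSer
  set m := hSer b 1 y / hSer b 0 y with hm
  have e : hSer b 1 y = m * hSer b 0 y := by rw [hm]; field_simp
  have h2 : m ^ 2 * hSer b 0 y ≤ hSer b 2 y := by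
    refine le_of_mul_le_mul_right ?_ h0
    rw [e] at hc
    nlinarith
  have h3 : (y - b * m) ^ 2 ≤ 4 + 2 * b ^ 2 := by
    refine le_of_mul_le_mul_right ?_ h0
    have := mul_le_mul_of_nonneg_left h2 (sq_nonneg b)
    rw [e] at hk
    nlinarith
  calc (-(2 * π) * y + 2 * π * b * m) ^ 2 = 4 * π ^ 2 * (y - b * m) ^ 2 := by ring
    _ ≤ _ := by gcongr

lemma GSer_hasDerivAt {b : ℝ} (hb : 0 < b) (y : ℝ) :
    HasDerivAt (GSer b) (-(2 * π) + 2 * π * b *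
      ((2 * π * b * hSer b 2 y * hSer b 0 y - hSer b 1 y * (2 * π * b * hSer b 1 y))
        / hSer b 0 y ^ 2)) y := by
  have h0 := hSer_zero_pos hb y
  have := ((hSer_hasDerivAt hb 1 y).div (hSer_hasDerivAt hb 0 y) h0.ne').const_mul (2 * π * b)
  have h2 := ((hasDerivAt_id y).const_mul (-(2 * π))).add this
  refine h2.congr_deriv ?_
  simp

lemma GSer_deriv_abs_le {b : ℝ} (hb : 0 < b) (y : ℝ) :
    |deriv (GSer b) y| ≤ 4 * π ^ 2 * (4 + 2 * b ^ 2) := by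
  rw [(GSer_hasDerivAt hb y).deriv]
  have h0 := hSer_zero_pos hb y
  have hc := hSer_cauchy hb y
  have hk := key_bound hb y
  set m := hSer b 1 y / hSer b 0 y with hm
  set m2 := hSer b 2 y / hSer b 0 y with hm2
  have e : hSer b 1 y = m * hSer b 0 y := by rw [hm]; field_simp
  have e2 : hSer b 2 y = m2 * hSer b 0 y := by rw [hm2]; field_simp
  rw [e, e2] at hc hk ⊢
  have h1 : m ^ 2 ≤ m2 := by
    refine le_of_mul_le_mul_right ?_ (mul_pos h0 h0)
    nlinarith
  have h3 : y ^ 2 - 2 * y * b * m + b ^ 2 * m2 ≤ 4 + 2 * b ^ 2 := by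
    refine le_of_mul_le_mul_right ?_ h0
    nlinarith
  have e3 : 2 * π * b *
      ((2 * π * b * (m2 * hSer b 0 y) * hSer b 0 y - m * hSer b 0 y * (2 * π * b * (m * hSer b 0 y)))
        / hSer b 0 y ^ 2) = 4 * π ^ 2 * (b ^ 2 * (m2 - m ^ 2)) := by
    field_simp
    ring
  rw [e3]
  have h4 : b ^ 2 * (m2 - m ^ 2) ≤ 4 + 2 * b ^ 2 := by nlinarith [sq_nonneg (y - b * m)]
  have h5 : 0 ≤ b ^ 2 * (m2 - m ^ 2) := mul_nonneg (sq_nonneg _) (by linarith)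
  have h6 : 4 * π ^ 2 * (b ^ 2 * (m2 - m ^ 2)) ≤ 4 * π ^ 2 * (4 + 2 * b ^ 2) := by gcongr
  have h7 : 0 ≤ 4 * π ^ 2 * (b ^ 2 * (m2 - m ^ 2)) := by positivity
  have hpi := Real.pi_gt_three
  have h8 : 2 * π ≤ 4 * π ^ 2 * (4 + 2 * b ^ 2) := by
    have : 0 ≤ π ^ 2 * b ^ 2 := by positivity
    nlinarith
  rw [abs_le]
  constructor <;> linarith

lemma GSer_lip {b : ℝ} (hb : 0 < b) (y z : ℝ) :
    |GSer b y - GSer b z| ≤ 4 * π ^ 2 * (4 + 2 * b ^ 2) * |y - z| := by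
  have := convex_univ.norm_image_sub_le_of_norm_deriv_le (f := GSer b) (s := Set.univ)
    (C := 4 * π ^ 2 * (4 + 2 * b ^ 2)) (x := z) (y := y)
    (fun x _ => (GSer_hasDerivAt hb x).differentiableAt)
    (fun x _ => GSer_deriv_abs_le hb x) trivial trivial
  simpa [Real.norm_eq_abs] using this

/-- Lattice spacing after rescaling. -/
noncomputable def spac (γ σ : ℝ) : ℝ := Real.sqrt (1 + σ ^ 2) / (γ * σ)

lemma spac_pos {γ σ : ℝ} (hγ : 1 < γ) (hσ : 0 < σ) : 0 < spac γ σ := by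
  unfold spac; positivity

lemma spac_sq_le {γ σ : ℝ} (hγ : 1 < γ) (hσ : 0 < σ) : spac γ σ ^ 2 ≤ 1 + 1 / σ ^ 2 := by
  unfold spac
  rw [div_pow, Real.sq_sqrt (by positivity), mul_pow]
  have : 1 ≤ γ ^ 2 := by nlinarith
  calc (1 + σ ^ 2) / (γ ^ 2 * σ ^ 2) ≤ (1 + σ ^ 2) / (1 * σ ^ 2) := by gcongr
    _ = _ := by field_simp; ring

lemma latticeMass_hasSum {γ : ℝ} (hγ : 1 < γ) :
    HasSum (fun k : ℤ => Real.exp (-Real.pi * ((k : ℝ) / γ) ^ 2)) (latticeMass γ) := by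
  have hb : 0 < 1 / γ := by positivity
  have := (F_hasSum hb 0).summable
  unfold latticeMass
  refine Summable.hasSum (this.congr fun k => ?_)
  congr 2; ring

lemma latticeMass_pos {γ : ℝ} (hγ : 1 < γ) : 0 < latticeMass γ :=
  (latticeMass_hasSum hγ).summable.tsum_pos (fun _ => (Real.exp_pos _).le) 0 (Real.exp_pos _)

lemma lattice_second {γ : ℝ} (hγ : 1 < γ) :
    ∃ S ≤ 6 * latticeMass γ,
      HasSum (fun k : ℤ => ((k : ℝ) / γ) ^ 2 * Real.exp (-Real.pi * ((k : ℝ) / γ) ^ 2)) S := by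
  have hb : 0 < 1 / γ := by positivity
  have h1 := F_hasSum hb 0
  have h2 := F2_hasSum hb 0
  have hk := key_bound hb 0
  have e : ∀ k : ℤ, (0 - 1 / γ * (k : ℝ)) ^ 2 = ((k : ℝ) / γ) ^ 2 := fun k => by ring
  simp only [e] at h1 h2
  refine ⟨_, ?_, h2⟩
  rw [(latticeMass_hasSum hγ).unique h1]
  have h3 : (1 / γ) ^ 2 ≤ 1 := by
    rw [div_pow, one_pow, div_le_one (by positivity)]; nlinarith
  have h0 := hSer_zero_pos hb 0
  have : (4 + 2 * (1 / γ) ^ 2) * hSer (1 / γ) 0 0 ≤ 6 * hSer (1 / γ) 0 0 := by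
    gcongr; linarith
  simp at *
  linarith

/-- Normalising constant. -/
noncomputable def Acon (γ σ : ℝ) : ℝ := Real.sqrt (1 + σ ^ 2) / (σ * latticeMass γ)

lemma Acon_pos {γ σ : ℝ} (hγ : 1 < γ) (hσ : 0 < σ) : 0 < Acon γ σ := by
  have := latticeMass_pos hγ
  unfold Acon; positivity

lemma LR_hasSum {γ σ : ℝ} (hγ : 1 < γ) (hσ : 0 < σ) (z : ℝ) :
    HasSum (fun k : ℤ =>
      Real.exp (-Real.pi * (z - Real.sqrt (1 + σ ^ 2) * (k : ℝ) / γ) ^ 2 / σ ^ 2))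
      (Real.exp (-π * (z / σ) ^ 2) * hSer (spac γ σ) 0 (z / σ)) := by
  have := F_hasSum (spac_pos hγ hσ) (z / σ)
  refine Eq.mp (congrArg (fun f => HasSum f _) (funext fun k => ?_)) this
  congr 1
  unfold spac
  field_simp

lemma pancakeLR_eq {γ σ : ℝ} (hγ : 1 < γ) (hσ : 0 < σ) (z : ℝ) :
    pancakeLR γ σ z =
      Acon γ σ * (Real.exp (-π * (z / σ) ^ 2) * hSer (spac γ σ) 0 (z / σ)) := by
  rw [pancakeLR, (LR_hasSum hγ hσ z).tsum_eq, Acon]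

lemma pancakeLR_pos {γ σ : ℝ} (hγ : 1 < γ) (hσ : 0 < σ) (z : ℝ) : 0 < pancakeLR γ σ z := by
  rw [pancakeLR_eq hγ hσ]
  have := Acon_pos hγ hσ
  have := hSer_zero_pos (spac_pos hγ hσ) (z / σ)
  positivity

lemma pancakeLR_hasDerivAt {γ σ : ℝ} (hγ : 1 < γ) (hσ : 0 < σ) (z : ℝ) :
    HasDerivAt (pancakeLR γ σ) (pancakeLR γ σ z * (GSer (spac γ σ) (z / σ) / σ)) z := by
  have hb := spac_pos hγ hσ
  have h0 := hSer_zero_pos hb (z / σ)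
  have hd : HasDerivAt (fun z : ℝ => z / σ) (1 / σ) z := (hasDerivAt_id z).div_const σ
  have h1 := (hSer_hasDerivAt hb 0 (z / σ)).comp z hd
  have h2 := ((hd.pow 2).const_mul (-π)).exp
  have h3 := (h2.mul h1).const_mul (Acon γ σ)
  rw [show HasDerivAt (pancakeLR γ σ) = HasDerivAt _ from
    congrArg HasDerivAt (funext (pancakeLR_eq hγ hσ))]
  refine h3.congr_deriv ?_
  rw [pancakeLR_eq hγ hσ]
  simp only [GSer, Function.comp, Pi.pow_apply]
  generalize z / σ = y at *
  simp only [Nat.reduceSub, Nat.cast_ofNat, zero_add, pow_one]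
  field_simp

lemma score_eq {γ σ : ℝ} (hγ : 1 < γ) (hσ : 0 < σ) (z : ℝ) :
    deriv (pancakeLR γ σ) z / pancakeLR γ σ z = GSer (spac γ σ) (z / σ) / σ := by
  rw [(pancakeLR_hasDerivAt hγ hσ z).deriv]
  have := pancakeLR_pos hγ hσ z
  field_simp

lemma pancakeLR_neg (γ σ z : ℝ) : pancakeLR γ σ (-z) = pancakeLR γ σ z := by
  unfold pancakeLR
  congr 1
  rw [← (Equiv.neg ℤ).tsum_eq]
  refine tsum_congr fun k => ?_
  simp only [Equiv.neg_apply]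
  push_cast
  congr 3
  ring

lemma score_neg (γ σ z : ℝ) :
    deriv (pancakeLR γ σ) (-z) / pancakeLR γ σ (-z)
      = -(deriv (pancakeLR γ σ) z / pancakeLR γ σ z) := by
  have h : deriv (fun z => pancakeLR γ σ (-z)) z = -deriv (pancakeLR γ σ) (-z) :=
    deriv_comp_neg _ _
  rw [funext (pancakeLR_neg γ σ)] at h
  have h' : deriv (pancakeLR γ σ) z = -deriv (pancakeLR γ σ) (-z) := h
  rw [pancakeLR_neg, h']
  ring

/-- maximum of the powers -/
lemma inv_pow_le_max {σ : ℝ} (hσ : 0 < σ) {n : ℕ} (hn : n ≤ 8) :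
    1 / σ ^ n ≤ max 1 (1 / σ ^ 8) := by
  rcases le_total 1 σ with h | h
  · refine le_max_of_le_left ?_
    rw [div_le_one (by positivity)]
    exact one_le_pow₀ h
  · refine le_max_of_le_right ?_
    exact one_div_le_one_div_of_le (by positivity) (pow_le_pow_of_le_one hσ.le h hn)

lemma score_sq_le {γ σ : ℝ} (hγ : 1 < γ) (hσ : 0 < σ) (z : ℝ) :
    (deriv (pancakeLR γ σ) z / pancakeLR γ σ z) ^ 2 ≤ 32 * π ^ 2 * max 1 (1 / σ ^ 8) := by
  rw [score_eq hγ hσ, div_pow]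
  have h1 := GSer_sq_le (spac_pos hγ hσ) (z / σ)
  have h2 := spac_sq_le hγ hσ
  have m2 := inv_pow_le_max hσ (n := 2) (by norm_num)
  have m4 := inv_pow_le_max hσ (n := 4) (by norm_num)
  calc GSer (spac γ σ) (z / σ) ^ 2 / σ ^ 2
      ≤ 4 * π ^ 2 * (4 + 2 * (1 + 1 / σ ^ 2)) / σ ^ 2 := by
        gcongr; exact h1.trans (by gcongr)
    _ = 4 * π ^ 2 * (6 * (1 / σ ^ 2) + 2 * (1 / σ ^ 4)) := by field_simp; ring
    _ ≤ 4 * π ^ 2 * (6 * max 1 (1 / σ ^ 8) + 2 * max 1 (1 / σ ^ 8)) := by gcongr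
    _ = _ := by ring

lemma score_lip_sq {γ σ : ℝ} (hγ : 1 < γ) (hσ : 0 < σ) (y z : ℝ) :
    (deriv (pancakeLR γ σ) y / pancakeLR γ σ y - deriv (pancakeLR γ σ) z / pancakeLR γ σ z) ^ 2
      ≤ 1024 * π ^ 4 * max 1 (1 / σ ^ 8) * (y - z) ^ 2 := by
  rw [score_eq hγ hσ, score_eq hγ hσ, ← sub_div, div_pow]
  have h1 := GSer_lip (spac_pos hγ hσ) (y / σ) (z / σ)
  have h2 := spac_sq_le hγ hσ
  have m4 := inv_pow_le_max hσ (n := 4) (by norm_num)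
  have m6 := inv_pow_le_max hσ (n := 6) (by norm_num)
  have m8 := inv_pow_le_max hσ (n := 8) (by norm_num)
  have h3 : |GSer (spac γ σ) (y / σ) - GSer (spac γ σ) (z / σ)|
      ≤ 4 * π ^ 2 * (4 + 2 * (1 + 1 / σ ^ 2)) * |y / σ - z / σ| := h1.trans (by gcongr)
  have h4 := pow_le_pow_left₀ (abs_nonneg _) h3 2
  rw [sq_abs, mul_pow, sq_abs] at h4
  calc _ ≤ (4 * π ^ 2 * (4 + 2 * (1 + 1 / σ ^ 2))) ^ 2 * (y / σ - z / σ) ^ 2 / σ ^ 2 := by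
        gcongr
    _ = 16 * π ^ 4 * (36 * (1 / σ ^ 4) + 24 * (1 / σ ^ 6) + 4 * (1 / σ ^ 8)) * (y - z) ^ 2 := by
        field_simp; ring
    _ ≤ 16 * π ^ 4 * (36 * max 1 (1 / σ ^ 8) + 24 * max 1 (1 / σ ^ 8)
          + 4 * max 1 (1 / σ ^ 8)) * (y - z) ^ 2 := by gcongr
    _ = _ := by ring

open ProbabilityTheory in
lemma pdf_zero (z : ℝ) :
    gaussianPDFReal 0 ((2 * Real.pi)⁻¹).toNNReal z = Real.exp (-π * z ^ 2) := by
  have h : (0 : ℝ) ≤ (2 * π)⁻¹ := by positivity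
  rw [gaussianPDFReal, Real.coe_toNNReal _ h]
  have : 2 * π * (2 * π)⁻¹ = 1 := by field_simp
  rw [this, Real.sqrt_one, inv_one, one_mul]
  congr 1
  field_simp
  ring

/-- Variance of the components. -/
noncomputable def v1 (σ : ℝ) : NNReal := (σ ^ 2 / (2 * π * (1 + σ ^ 2))).toNNReal

lemma v1_coe (σ : ℝ) : (v1 σ : ℝ) = σ ^ 2 / (2 * π * (1 + σ ^ 2)) :=
  Real.coe_toNNReal _ (by positivity)

open ProbabilityTheory in
lemma pdf_mul {γ σ : ℝ} (hγ : 1 < γ) (hσ : 0 < σ) (k : ℤ) (z : ℝ) :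
    Real.exp (-π * z ^ 2) * (Acon γ σ *
      Real.exp (-Real.pi * (z - Real.sqrt (1 + σ ^ 2) * (k : ℝ) / γ) ^ 2 / σ ^ 2)) =
    (Real.exp (-Real.pi * ((k : ℝ) / γ) ^ 2) / latticeMass γ) *
      gaussianPDFReal ((k : ℝ) / γ / Real.sqrt (1 + σ ^ 2)) (v1 σ) z := by
  have hM := latticeMass_pos hγ
  rw [gaussianPDFReal, v1_coe, Acon]
  have hs2 : Real.sqrt (1 + σ ^ 2) ^ 2 = 1 + σ ^ 2 := Real.sq_sqrt (by positivity)
  have hs : 0 < Real.sqrt (1 + σ ^ 2) := by positivity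
  have e1 : Real.sqrt (2 * π * (σ ^ 2 / (2 * π * (1 + σ ^ 2)))) = σ / Real.sqrt (1 + σ ^ 2) := by
    rw [← Real.sqrt_sq (by positivity : 0 ≤ σ / Real.sqrt (1 + σ ^ 2)), div_pow, hs2]
    congr 1
    field_simp
  rw [e1]
  generalize Real.sqrt (1 + σ ^ 2) = s at *
  rw [← hs2]
  have e2 : Real.exp (-π * z ^ 2) * Real.exp (-π * (z - s * (k : ℝ) / γ) ^ 2 / σ ^ 2) =
      Real.exp (-π * ((k : ℝ) / γ) ^ 2) *
        Real.exp (-(z - (k : ℝ) / γ / s) ^ 2 / (2 * (σ ^ 2 / (2 * π * s ^ 2)))) := by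
    rw [← Real.exp_add, ← Real.exp_add]
    congr 1
    have hg : γ ≠ 0 := by positivity
    have e3 : -(z - (k : ℝ) / γ / s) ^ 2 / (2 * (σ ^ 2 / (2 * π * s ^ 2)))
       = -π * (s * z - (k : ℝ) / γ) ^ 2 / σ ^ 2 := by
      field_simp
    rw [e3, mul_div_assoc s]
    generalize (k : ℝ) / γ = c
    have e4 : s ^ 2 = 1 + σ ^ 2 := hs2
    field_simp
    linear_combination (z ^ 2 - c ^ 2) * e4
  have e5 : (σ / s)⁻¹ = s / σ := by simp
  rw [e5]
  calc _ = s / (σ * latticeMass γ) * (Real.exp (-π * z ^ 2) * Real.exp (-π * (z - s * (k : ℝ) / γ) ^ 2 / σ ^ 2)) := by ring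
    _ = _ := by rw [e2]; field_simp

lemma pancakeLR_continuous {γ σ : ℝ} (hγ : 1 < γ) (hσ : 0 < σ) : Continuous (pancakeLR γ σ) :=
  continuous_iff_continuousAt.2 fun z => (pancakeLR_hasDerivAt hγ hσ z).continuousAt

open ProbabilityTheory in
lemma mixture {γ σ : ℝ} (hγ : 1 < γ) (hσ : 0 < σ) {φ : ℝ → ENNReal} (hφ : Measurable φ) :
    ∫⁻ z, ENNReal.ofReal (pancakeLR γ σ z) * φ z
        ∂(gaussianReal 0 ((2 * Real.pi)⁻¹).toNNReal) =
      ∑' k : ℤ, ENNReal.ofReal (Real.exp (-Real.pi * ((k : ℝ) / γ) ^ 2) / latticeMass γ) *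
        ∫⁻ z, φ z ∂(gaussianReal ((k : ℝ) / γ / Real.sqrt (1 + σ ^ 2)) (v1 σ)) := by
  have hM := latticeMass_pos hγ
  have hA := Acon_pos hγ hσ
  have hm := (pancakeLR_continuous hγ hσ).measurable
  have hv0 : ((2 * Real.pi)⁻¹).toNNReal ≠ 0 := by
    rw [Ne, Real.toNNReal_eq_zero, not_le]; positivity
  have hv1 : v1 σ ≠ 0 := by
    rw [v1, Ne, Real.toNNReal_eq_zero, not_le]; positivity
  have hpt : ∀ z, gaussianPDF 0 ((2 * Real.pi)⁻¹).toNNReal z * ENNReal.ofReal (pancakeLR γ σ z) =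
      ∑' k : ℤ, ENNReal.ofReal (Real.exp (-Real.pi * ((k : ℝ) / γ) ^ 2) / latticeMass γ) *
        gaussianPDF ((k : ℝ) / γ / Real.sqrt (1 + σ ^ 2)) (v1 σ) z := by
    intro z
    have hs := ((LR_hasSum hγ hσ z).mul_left (Acon γ σ)).mul_left (Real.exp (-π * z ^ 2))
    rw [gaussianPDF, pdf_zero, ← ENNReal.ofReal_mul (by positivity), pancakeLR_eq hγ hσ,
      ← hs.tsum_eq, ENNReal.ofReal_tsum_of_nonneg (fun k => by positivity) hs.summable]
    refine tsum_congr fun k => ?_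
    rw [pdf_mul hγ hσ, ENNReal.ofReal_mul (by positivity)]
    rfl
  rw [gaussianReal_of_var_ne_zero _ hv0,
    lintegral_withDensity_eq_lintegral_mul _ (measurable_gaussianPDF _ _) (by fun_prop)]
  simp_rw [gaussianReal_of_var_ne_zero _ hv1]
  have : ∀ z, (gaussianPDF 0 ((2 * Real.pi)⁻¹).toNNReal *
      fun z => ENNReal.ofReal (pancakeLR γ σ z) * φ z) z = 
      ∑' k : ℤ, ENNReal.ofReal (Real.exp (-Real.pi * ((k : ℝ) / γ) ^ 2) / latticeMass γ) *
        (gaussianPDF ((k : ℝ) / γ / Real.sqrt (1 + σ ^ 2)) (v1 σ) z * φ z) := by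
    intro z
    rw [Pi.mul_apply, ← mul_assoc, hpt, ← ENNReal.tsum_mul_right]
    simp_rw [mul_assoc]
  rw [lintegral_congr this, lintegral_tsum]
  · refine tsum_congr fun k => ?_
    rw [lintegral_withDensity_eq_lintegral_mul _ (measurable_gaussianPDF _ _) hφ,
      lintegral_const_mul]
    · rfl
    · have := measurable_gaussianPDF ((k : ℝ) / γ / Real.sqrt (1 + σ ^ 2)) (v1 σ)
      fun_prop
  · intro k
    have := measurable_gaussianPDF ((k : ℝ) / γ / Real.sqrt (1 + σ ^ 2)) (v1 σ)
    fun_prop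

open ProbabilityTheory in
lemma gaussian_second (m : ℝ) (v : NNReal) :
    ∫⁻ z, ENNReal.ofReal (z ^ 2) ∂(gaussianReal m v) = ENNReal.ofReal (v + m ^ 2) := by
  have hL : MemLp (id : ℝ → ℝ) 2 (gaussianReal m v) := memLp_id_gaussianReal 2
  have hi : Integrable (fun z : ℝ => z ^ 2) (gaussianReal m v) := hL.integrable_sq
  rw [← ofReal_integral_eq_lintegral_ofReal hi (ae_of_all _ fun z => sq_nonneg z)]
  congr 1
  have h := variance_eq_sub hL
  rw [variance_id_gaussianReal] at h
  simp only [Pi.pow_apply, id] at h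
  rw [integral_id_gaussianReal] at h
  linarith

open ProbabilityTheory in
lemma LR_mass {γ σ : ℝ} (hγ : 1 < γ) (hσ : 0 < σ) :
    ∫⁻ z, ENNReal.ofReal (pancakeLR γ σ z)
        ∂(gaussianReal 0 ((2 * Real.pi)⁻¹).toNNReal) = 1 := by
  have hM := latticeMass_pos hγ
  have h := mixture hγ hσ (φ := fun _ => 1) measurable_const
  simp only [mul_one, lintegral_const, measure_univ] at h
  have hs := (latticeMass_hasSum hγ).div_const (latticeMass γ)
  rw [h, ← ENNReal.ofReal_tsum_of_nonneg (fun k => by positivity) hs.summable, hs.tsum_eq,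
    div_self hM.ne', ENNReal.ofReal_one]

open ProbabilityTheory in
lemma LR_second {γ σ : ℝ} (hγ : 1 < γ) (hσ : 0 < σ) :
    ∫⁻ z, ENNReal.ofReal (pancakeLR γ σ z) * ENNReal.ofReal (z ^ 2)
        ∂(gaussianReal 0 ((2 * Real.pi)⁻¹).toNNReal) ≤ ENNReal.ofReal 7 := by
  have hM := latticeMass_pos hγ
  rw [mixture hγ hσ (φ := fun z => ENNReal.ofReal (z ^ 2)) (by fun_prop)]
  simp_rw [gaussian_second]
  obtain ⟨S, hS, hsum⟩ := lattice_second hγ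
  have hv : (v1 σ : ℝ) ≤ 1 := by
    rw [v1_coe, div_le_one (by positivity)]
    nlinarith [Real.pi_gt_three, sq_nonneg σ]
  have hs := ((latticeMass_hasSum hγ).add hsum).div_const (latticeMass γ)
  have hle : ∀ k : ℤ, ENNReal.ofReal (Real.exp (-Real.pi * ((k : ℝ) / γ) ^ 2) / latticeMass γ) *
      ENNReal.ofReal (v1 σ + ((k : ℝ) / γ / Real.sqrt (1 + σ ^ 2)) ^ 2) ≤
      ENNReal.ofReal ((Real.exp (-Real.pi * ((k : ℝ) / γ) ^ 2) + ((k : ℝ) / γ) ^ 2 *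
        Real.exp (-Real.pi * ((k : ℝ) / γ) ^ 2)) / latticeMass γ) := by
    intro k
    rw [← ENNReal.ofReal_mul (by positivity)]
    refine ENNReal.ofReal_le_ofReal ?_
    have h1 : ((k : ℝ) / γ / Real.sqrt (1 + σ ^ 2)) ^ 2 ≤ ((k : ℝ) / γ) ^ 2 := by
      rw [div_pow _ (Real.sqrt _), Real.sq_sqrt (by positivity)]
      exact div_le_self (sq_nonneg _) (by nlinarith [sq_nonneg σ])
    calc _ ≤ Real.exp (-Real.pi * ((k : ℝ) / γ) ^ 2) / latticeMass γ * (1 + ((k : ℝ) / γ) ^ 2) := by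
          gcongr
      _ = _ := by ring
  refine (ENNReal.tsum_le_tsum hle).trans ?_
  rw [← ENNReal.ofReal_tsum_of_nonneg (fun k => by positivity) hs.summable, hs.tsum_eq]
  refine ENNReal.ofReal_le_ofReal ?_
  rw [div_le_iff₀ hM]
  linarith

section pidim
open ProbabilityTheory

variable {d : ℕ}

instance : IsProbabilityMeasure (_root_.stdGaussian d) := by
  unfold _root_.stdGaussian; infer_instance

lemma coord_law (i : Fin d) : (_root_.stdGaussian d).map (fun x => x i) =
    gaussianReal 0 ((2 * Real.pi)⁻¹).toNNReal :=
  (measurePreserving_eval (fun _ : Fin d => gaussianReal 0 ((2 * Real.pi)⁻¹).toNNReal) i).map_eq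

lemma coord_indep : iIndepFun (fun (i : Fin d) (x : Fin d → ℝ) => x i) (_root_.stdGaussian d) :=
  iIndepFun_pi (X := fun _ => id) (fun _ => aemeasurable_id)

lemma coord_gauss (i : Fin d) : HasGaussianLaw (fun x : Fin d → ℝ => x i) (_root_.stdGaussian d) :=
  ⟨by rw [coord_law]; infer_instance⟩

lemma vec_gauss : HasGaussianLaw (fun x : Fin d → ℝ => (x · )) (_root_.stdGaussian d) :=
  coord_indep.hasGaussianLaw coord_gauss

/-- linear functional -/
noncomputable def linf (u : Fin d → ℝ) : (Fin d → ℝ) →L[ℝ] ℝ :=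
  ∑ i, (u i) • (ContinuousLinearMap.proj (R := ℝ) (φ := fun _ : Fin d => ℝ) i)

lemma linf_apply (u x : Fin d → ℝ) : linf u x = ∑ i, x i * u i := by
  simp [linf, mul_comm]

lemma pair_gauss (u v : Fin d → ℝ) :
    HasGaussianLaw (fun x : Fin d → ℝ => (linf u x, linf v x)) (_root_.stdGaussian d) :=
  vec_gauss.map_fun ((linf u).prod (linf v))

lemma lin_gauss (u : Fin d → ℝ) :
    HasGaussianLaw (fun x : Fin d → ℝ => linf u x) (_root_.stdGaussian d) :=
  vec_gauss.map_fun (linf u)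

lemma coord_var (i : Fin d) :
    Var[fun x : Fin d → ℝ => x i; _root_.stdGaussian d] = (2 * π)⁻¹ := by
  have h := variance_id_map (μ := _root_.stdGaussian d) (X := fun x : Fin d → ℝ => x i)
    (measurable_pi_apply i).aemeasurable
  rw [← h, coord_law, variance_id_gaussianReal, Real.coe_toNNReal _ (by positivity)]

lemma coord_mean (i : Fin d) : ∫ x, x i ∂(_root_.stdGaussian d) = 0 := by
  have h := integral_map (μ := _root_.stdGaussian d) (φ := fun x : Fin d → ℝ => x i)
    (f := fun z : ℝ => z) (measurable_pi_apply i).aemeasurable (by fun_prop)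
  rw [← h, coord_law, integral_id_gaussianReal]

lemma coord_cov (i j : Fin d) :
    cov[fun x : Fin d → ℝ => x i, fun x => x j; _root_.stdGaussian d] =
      if i = j then (2 * π)⁻¹ else 0 := by
  split_ifs with h
  · subst h
    rw [covariance_self (measurable_pi_apply i).aemeasurable, coord_var]
  · exact (coord_indep.indepFun h).covariance_eq_zero (coord_gauss i).memLp_two
      (coord_gauss j).memLp_two

lemma lin_cov (u v : Fin d → ℝ) :
    cov[fun x : Fin d → ℝ => linf u x, fun x => linf v x; _root_.stdGaussian d] =
      (2 * π)⁻¹ * ∑ i, u i * v i := by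
  simp_rw [linf_apply]
  have hm : ∀ (w : Fin d → ℝ) (i : Fin d), 
      MemLp (fun x : Fin d → ℝ => x i * w i) 2 (_root_.stdGaussian d) := fun w i =>
    (coord_gauss i).memLp_two.mul_const (w i)
  rw [covariance_fun_sum_fun_sum (hm u) (hm v)]
  simp_rw [covariance_mul_const_left, covariance_mul_const_right, coord_cov]
  simp [Finset.mul_sum, mul_comm, mul_assoc]

lemma lin_mean (u : Fin d → ℝ) : ∫ x, linf u x ∂(_root_.stdGaussian d) = 0 := by
  simp_rw [linf_apply]
  rw [integral_finsetSum]
  · simp [integral_mul_const, coord_mean]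
  · exact fun i _ => (coord_gauss i).integrable.mul_const _

lemma lin_law (u : Fin d → ℝ) : (_root_.stdGaussian d).map (fun x => linf u x) =
    gaussianReal 0 ((2 * Real.pi)⁻¹ * ∑ i, u i ^ 2).toNNReal := by
  rw [(lin_gauss u).map_eq_gaussianReal, lin_mean, ← covariance_self (by fun_prop), lin_cov]
  simp_rw [sq]

lemma lin_second (u : Fin d → ℝ) :
    ∫⁻ x, ENNReal.ofReal ((linf u x) ^ 2) ∂(_root_.stdGaussian d) =
      ENNReal.ofReal ((2 * Real.pi)⁻¹ * ∑ i, u i ^ 2) := by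
  have h := lintegral_map (μ := _root_.stdGaussian d) (g := fun x => linf u x)
    (f := fun z : ℝ => ENNReal.ofReal (z ^ 2)) (by fun_prop) (by fun_prop)
  rw [← h, lin_law, gaussian_second, Real.coe_toNNReal]
  · simp
  · have : 0 ≤ ∑ i, u i ^ 2 := Finset.sum_nonneg fun i _ => sq_nonneg _
    positivity

lemma unit_lint {u : Fin d → ℝ} (hu : ∑ i, u i ^ 2 = 1) {f : ℝ → ENNReal} (hf : Measurable f) :
    ∫⁻ x, f (linf u x) ∂(_root_.stdGaussian d) =
      ∫⁻ z, f z ∂(gaussianReal 0 ((2 * Real.pi)⁻¹).toNNReal) := by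
  have h := lintegral_map (μ := _root_.stdGaussian d) (g := fun x => linf u x)
    (f := f) hf (by fun_prop)
  rw [← h, lin_law, hu, mul_one]

lemma pancakes_lint {γ σ : ℝ} (hγ : 1 < γ) (hσ : 0 < σ) (u : Fin d → ℝ)
    {f : (Fin d → ℝ) → ENNReal} (hf : Measurable f) :
    ∫⁻ x, f x ∂(pancakes d γ σ u) =
      ∫⁻ x, ENNReal.ofReal (pancakeLR γ σ (linf u x)) * f x ∂(_root_.stdGaussian d) := by
  have hm := (pancakeLR_continuous hγ hσ).measurable
  unfold pancakes
  simp_rw [← linf_apply]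
  rw [lintegral_withDensity_eq_lintegral_mul _ (by fun_prop) hf]
  rfl

lemma pancakes_prob {γ σ : ℝ} (hγ : 1 < γ) (hσ : 0 < σ) {u : Fin d → ℝ}
    (hu : ∑ i, u i ^ 2 = 1) : IsProbabilityMeasure (pancakes d γ σ u) := by
  have hm := (pancakeLR_continuous hγ hσ).measurable
  refine ⟨?_⟩
  rw [← lintegral_one, pancakes_lint hγ hσ u measurable_const]
  simp only [mul_one]
  rw [unit_lint hu (f := fun z => ENNReal.ofReal (pancakeLR γ σ z)) (by fun_prop), LR_mass hγ hσ]

lemma pancakes_second {γ σ : ℝ} (hγ : 1 < γ) (hσ : 0 < σ) {u : Fin d → ℝ}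
    (hu : ∑ i, u i ^ 2 = 1) (w : Fin d → ℝ) :
    ∫⁻ x, ENNReal.ofReal ((linf w x) ^ 2) ∂(pancakes d γ σ u) ≤
      ENNReal.ofReal (16 * ∑ i, w i ^ 2) := by
  have hm := (pancakeLR_continuous hγ hσ).measurable
  set α := ∑ i, u i * w i with hα
  set v : Fin d → ℝ := fun i => w i - α * u i with hv
  have huv : ∑ i, u i * v i = 0 := by
    have : ∀ i, u i * v i = u i * w i - α * u i ^ 2 := fun i => by simp only [hv]; ring
    simp_rw [this]
    rw [Finset.sum_sub_distrib, ← Finset.mul_sum, hu, ← hα]; ring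
  have hvv : ∑ i, v i ^ 2 = ∑ i, w i ^ 2 - α ^ 2 := by
    have : ∀ i, v i ^ 2 = w i ^ 2 - 2 * α * (u i * w i) + α ^ 2 * u i ^ 2 :=
      fun i => by simp only [hv]; ring
    simp_rw [this]
    rw [Finset.sum_add_distrib, Finset.sum_sub_distrib, ← Finset.mul_sum, ← Finset.mul_sum,
      hu, ← hα]; ring
  have hv0 : 0 ≤ ∑ i, v i ^ 2 := Finset.sum_nonneg fun i _ => sq_nonneg _
  have hdec : ∀ x, linf w x = α * linf u x + linf v x := by
    intro x
    simp_rw [linf_apply, Finset.mul_sum]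
    rw [← Finset.sum_add_distrib]
    refine Finset.sum_congr rfl fun i _ => ?_
    simp only [hv]; ring
  have hind : IndepFun (fun x : Fin d → ℝ => linf u x) (fun x => linf v x)
      (_root_.stdGaussian d) :=
    (pair_gauss u v).indepFun_of_covariance_eq_zero (by rw [lin_cov, huv, mul_zero])
  have hA : ∫⁻ x, ENNReal.ofReal (pancakeLR γ σ (linf u x)) * ENNReal.ofReal ((linf u x) ^ 2)
      ∂(_root_.stdGaussian d) ≤ ENNReal.ofReal 7 := by
    rw [unit_lint hu (f := fun z => ENNReal.ofReal (pancakeLR γ σ z) * ENNReal.ofReal (z ^ 2))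
      (by fun_prop)]
    exact LR_second hγ hσ
  have hB : ∫⁻ x, ENNReal.ofReal (pancakeLR γ σ (linf u x)) * ENNReal.ofReal ((linf v x) ^ 2)
      ∂(_root_.stdGaussian d) = ENNReal.ofReal ((2 * Real.pi)⁻¹ * ∑ i, v i ^ 2) := by
    have hc := hind.comp (φ := fun z => ENNReal.ofReal (pancakeLR γ σ z))
      (ψ := fun z : ℝ => ENNReal.ofReal (z ^ 2)) (by fun_prop) (by fun_prop)
    have := lintegral_mul_eq_lintegral_mul_lintegral_of_indepFun (by fun_prop) (by fun_prop) hc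
    simp only [Pi.mul_apply, Function.comp_apply] at this
    rw [this, lin_second,
      unit_lint hu (f := fun z => ENNReal.ofReal (pancakeLR γ σ z)) (by fun_prop),
      LR_mass hγ hσ, one_mul]
  rw [pancakes_lint hγ hσ u (by fun_prop)]
  have hle : ∀ x : Fin d → ℝ,
      ENNReal.ofReal (pancakeLR γ σ (linf u x)) * ENNReal.ofReal ((linf w x) ^ 2) ≤
      ENNReal.ofReal (2 * α ^ 2) *
        (ENNReal.ofReal (pancakeLR γ σ (linf u x)) * ENNReal.ofReal ((linf u x) ^ 2)) +
      ENNReal.ofReal 2 *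
        (ENNReal.ofReal (pancakeLR γ σ (linf u x)) * ENNReal.ofReal ((linf v x) ^ 2)) := by
    intro x
    have hp := (pancakeLR_pos hγ hσ (linf u x)).le
    rw [← ENNReal.ofReal_mul hp, ← ENNReal.ofReal_mul hp, ← ENNReal.ofReal_mul hp,
      ← ENNReal.ofReal_mul (by positivity), ← ENNReal.ofReal_mul (by positivity),
      ← ENNReal.ofReal_add (by positivity) (by positivity)]
    refine ENNReal.ofReal_le_ofReal ?_
    rw [hdec]
    have : (α * linf u x + linf v x) ^ 2 ≤ 2 * α ^ 2 * (linf u x) ^ 2 + 2 * (linf v x) ^ 2 := by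
      nlinarith [sq_nonneg (α * linf u x - linf v x)]
    calc _ ≤ pancakeLR γ σ (linf u x) * (2 * α ^ 2 * (linf u x) ^ 2 + 2 * (linf v x) ^ 2) := by
          gcongr
      _ = _ := by ring
  refine (lintegral_mono hle).trans ?_
  rw [lintegral_add_left (by fun_prop), lintegral_const_mul _ (by fun_prop),
    lintegral_const_mul _ (by fun_prop), hB]
  refine (add_le_add_left (mul_le_mul_right hA _) _).trans ?_
  rw [← ENNReal.ofReal_mul (by positivity), ← ENNReal.ofReal_mul (by positivity),
    ← ENNReal.ofReal_add (by positivity) (by positivity)]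
  refine ENNReal.ofReal_le_ofReal ?_
  have hpi : (2 * π)⁻¹ ≤ 1 := inv_le_one_of_one_le₀ (by linarith [Real.pi_gt_three])
  have h1 : (2 * π)⁻¹ * ∑ i, v i ^ 2 ≤ 1 * ∑ i, v i ^ 2 := by gcongr
  nlinarith [sq_nonneg α]

end pidim

lemma core_bound {d : ℕ} {γ σ : ℝ} (hγ : 1 < γ) (hσ : 0 < σ) {u uhat : Fin d → ℝ}
    (hu : ∑ i, u i ^ 2 = 1) (huh : ∑ i, uhat i ^ 2 = 1) {η : ℝ} (hη : 0 < η)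
    (hρ : 1 - (∑ i, uhat i * u i) ^ 2 ≤ η ^ 2) (hpos : 0 ≤ ∑ i, uhat i * u i) :
    (∫ x, (∑ i, (pancakesScoreFun d γ σ uhat x i - pancakesScoreFun d γ σ u x i) ^ 2)
          ∂(pancakes d γ σ u))
        ≤ (65536 * π ^ 4 + 128 * π ^ 2) * max 1 (1 / σ ^ 8) * η ^ 2 * d := by
  have hprob := pancakes_prob hγ hσ hu
  set X := max 1 (1 / σ ^ 8) with hX
  have hX0 : 0 ≤ X := le_max_of_le_left zero_le_one
  set w : Fin d → ℝ := fun i => uhat i - u i with hw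
  set ρ := ∑ i, uhat i * u i with hρdef
  have hww : ∑ i, w i ^ 2 = 2 - 2 * ρ := by
    have : ∀ i, w i ^ 2 = uhat i ^ 2 - 2 * (uhat i * u i) + u i ^ 2 :=
      fun i => by simp only [hw]; ring
    simp_rw [this]
    rw [Finset.sum_add_distrib, Finset.sum_sub_distrib, ← Finset.mul_sum, hu, huh, ← hρdef]; ring
  have hw0 : 0 ≤ ∑ i, w i ^ 2 := Finset.sum_nonneg fun i _ => sq_nonneg _
  have hwη : ∑ i, w i ^ 2 ≤ 2 * η ^ 2 := by nlinarith
  have hd : (1 : ℝ) ≤ d := by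
    rcases Nat.eq_zero_or_pos d with h | h
    · subst h; simp at hu
    · exact_mod_cast h
  set g : (Fin d → ℝ) → ℝ := fun x =>
    2048 * π ^ 4 * X * (linf w x) ^ 2 + 64 * π ^ 2 * X * ∑ i, w i ^ 2 with hg
  have hpt : ∀ x, (∑ i, (pancakesScoreFun d γ σ uhat x i - pancakesScoreFun d γ σ u x i) ^ 2)
      ≤ g x := by
    intro x
    unfold pancakesScoreFun
    rw [← linf_apply, ← linf_apply]
    have h1 := score_lip_sq hγ hσ (linf uhat x) (linf u x)
    have h2 := score_sq_le hγ hσ (linf u x)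
    have e : linf uhat x - linf u x = linf w x := by
      simp_rw [linf_apply, hw, mul_sub, Finset.sum_sub_distrib]
    rw [e] at h1
    generalize deriv (pancakeLR γ σ) (linf uhat x) / pancakeLR γ σ (linf uhat x) = a at *
    generalize deriv (pancakeLR γ σ) (linf u x) / pancakeLR γ σ (linf u x) = c at *
    calc _ ≤ ∑ i, (2 * (a - c) ^ 2 * uhat i ^ 2 + 2 * c ^ 2 * w i ^ 2) := by
          refine Finset.sum_le_sum fun i _ => ?_
          simp only [hw]
          nlinarith [sq_nonneg ((a - c) * uhat i - c * (uhat i - u i))]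
      _ = 2 * (a - c) ^ 2 + 2 * c ^ 2 * ∑ i, w i ^ 2 := by
          rw [Finset.sum_add_distrib, ← Finset.mul_sum, ← Finset.mul_sum, huh, mul_one]
      _ ≤ 2 * (1024 * π ^ 4 * X * (linf w x) ^ 2) + 2 * (32 * π ^ 2 * X) * ∑ i, w i ^ 2 := by
          gcongr
      _ = g x := by rw [hg]; ring
  have hsec := pancakes_second hγ hσ hu w
  have hi : Integrable (fun x => (linf w x) ^ 2) (pancakes d γ σ u) := by
    refine ⟨by fun_prop, ?_⟩
    rw [hasFiniteIntegral_iff_ofReal (ae_of_all _ fun x => sq_nonneg _)]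
    exact hsec.trans_lt ENNReal.ofReal_lt_top
  have hI : ∫ x, (linf w x) ^ 2 ∂(pancakes d γ σ u) ≤ 16 * ∑ i, w i ^ 2 := by
    rw [← ofReal_integral_eq_lintegral_ofReal hi (ae_of_all _ fun x => sq_nonneg _)] at hsec
    exact (ENNReal.ofReal_le_ofReal_iff (by positivity)).1 hsec
  have hgi : Integrable g (pancakes d γ σ u) := (hi.const_mul _).add (integrable_const _)
  have hgI : ∫ x, g x ∂(pancakes d γ σ u) = 2048 * π ^ 4 * X *
      ∫ x, (linf w x) ^ 2 ∂(pancakes d γ σ u) + 64 * π ^ 2 * X * ∑ i, w i ^ 2 := by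
    rw [hg, integral_add (hi.const_mul _) (integrable_const _), integral_const_mul]
    simp
  calc _ ≤ ∫ x, g x ∂(pancakes d γ σ u) :=
        integral_mono_of_nonneg
          (ae_of_all _ fun x => Finset.sum_nonneg fun i _ => sq_nonneg _) hgi (ae_of_all _ hpt)
    _ ≤ 2048 * π ^ 4 * X * (16 * (2 * η ^ 2)) + 64 * π ^ 2 * X * (2 * η ^ 2) := by
        rw [hgI]
        gcongr
        exact hI.trans (by gcongr)
    _ = (65536 * π ^ 4 + 128 * π ^ 2) * X * η ^ 2 * 1 := by ring
    _ ≤ _ := by gcongr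

/-- Score-to-parameter estimation reduction: there is a universal constant `C > 0`
such that for all `γ > 1`, `σ > 0`, unit vectors `u, û` with `1 − ⟨û,u⟩² ≤ η²`
(`η ∈ (0,1)`), the plug-in score estimate `ŝ(x) = −2πx + (T'/T)(⟨x,û⟩)û` satisfies
`E_{x∼P_u} ‖ŝ(x) − ∇log P_u(x)‖² ≤ C·max(1, 1/σ⁸)·η²·d`. -/
theorem score_to_parameter_reduction :
    ∃ C > (0 : ℝ), ∀ (d : ℕ) (γ σ : ℝ), 1 < γ → 0 < σ →
      ∀ (u uhat : Fin d → ℝ), (∑ i, (u i) ^ 2 = 1) → (∑ i, (uhat i) ^ 2 = 1) →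
      ∀ η : ℝ, 0 < η → η < 1 → 1 - (∑ i, uhat i * u i) ^ 2 ≤ η ^ 2 →
      (∫ x, (∑ i, (pancakesScoreFun d γ σ uhat x i - pancakesScoreFun d γ σ u x i) ^ 2)
          ∂(pancakes d γ σ u))
        ≤ C * max 1 (1 / σ ^ 8) * η ^ 2 * d := by
  refine ⟨65536 * π ^ 4 + 128 * π ^ 2, by positivity, ?_⟩
  intro d γ σ hγ hσ u uhat hu huh η hη _ hρ
  rcases le_total 0 (∑ i, uhat i * u i) with h | h
  · exact core_bound hγ hσ hu huh hη hρ h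
  · have hneg : pancakesScoreFun d γ σ (fun i => -uhat i) = pancakesScoreFun d γ σ uhat := by
      funext x i
      unfold pancakesScoreFun
      have : ∑ j, x j * -uhat j = -∑ j, x j * uhat j := by
        simp [Finset.sum_neg_distrib]
      rw [this, score_neg]
      ring
    have e : ∑ i, -uhat i * u i = -∑ i, uhat i * u i := by
      simp [Finset.sum_neg_distrib]
    have := core_bound hγ hσ hu (uhat := fun i => -uhat i) (by simpa using huh) hη
      (by rw [e, neg_sq]; exact hρ) (by rw [e]; linarith)
    rwa [hneg] at this
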